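/- Let (R, m) be an analytically unramified Cohen-Macaulay local ring of dimension d > 0 with infinite residue field, I an m-primary ideal, J a minimal reduction, and S̄ ≠ 0 the Sally module of the normal filtration. Then the multiplicity of S̄ equals ē₁(I) − e₀(I) + λ(R/closure(I)), and the i-th normalized Hilbert coefficient of S̄ equals ē_{i+1}(I) for 1 ≤ i ≤ d−1. -/

import Mathlib

set_option synthInstance.maxHeartbeats 1000000
set_option maxHeartbeats 2000000

open IsLocalRing Polynomial Finset

variable {R : Type*}

/-- `x` is integral over the ideal `I`: it satisfies an equation
`x^n + a₁ x^{n-1} + ⋯ + aₙ = 0` with `aᵢ ∈ Iⁱ`. -/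
def IsIntegralOverIdeal [CommRing R] (I : Ideal R) (x : R) : Prop :=
  ∃ n : ℕ, 0 < n ∧ ∃ a : ℕ → R, (∀ i ∈ Finset.Icc 1 n, a i ∈ I ^ i) ∧
    x ^ n + ∑ i ∈ Finset.Icc 1 n, a i * x ^ (n - i) = 0

/-- The integral closure of an ideal (the set of integral elements is an ideal,
so the span equals it). -/
def intCl [CommRing R] (I : Ideal R) : Ideal R :=
  Ideal.span {x | IsIntegralOverIdeal I x}

/-- Length of a module, as the Krull dimension of its lattice of submodules. -/
noncomputable def mlen (R M : Type*) [CommRing R] [AddCommGroup M] [Module R M] :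
    WithBot ℕ∞ :=
  Order.krullDim (Submodule R M)

/-- The quotient module `N/(K ∩ N)` for ideals `N K`. -/
abbrev idealQuot [CommRing R] (N K : Ideal R) :=
  N ⧸ (Submodule.comap N.subtype K)

/-- Depth of `M` with respect to the ideal `J`: sup of lengths of `M`-regular
sequences contained in `J`. -/
noncomputable def rdepth (A : Type*) [CommRing A] (J : Ideal A)
    (M : Type*) [AddCommGroup M] [Module A M] : ℕ∞ :=
  sSup {n : ℕ∞ | ∃ rs : List A, (rs.length : ℕ∞) = n ∧ (∀ x ∈ rs, x ∈ J) ∧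
    RingTheory.Sequence.IsRegular M rs}

/-- A local ring is Cohen-Macaulay if its depth equals its Krull dimension. -/
def IsCMLocal (R : Type*) [CommRing R] [IsLocalRing R] : Prop :=
  (rdepth R (maximalIdeal R) R : WithBot ℕ∞) = ringKrullDim R

/-- A local ring is analytically unramified if its `m`-adic completion is reduced. -/
def AnalyticallyUnramified (R : Type*) [CommRing R] [IsLocalRing R] : Prop :=
  IsReduced (AdicCompletion (maximalIdeal R) R)

/-- An ideal is `m`-primary. -/
def IsMPrimary [CommRing R] [IsLocalRing R] (I : Ideal R) : Prop :=
  I.radical = maximalIdeal R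

/-- `J ⊆ I` is a minimal reduction: generated by `d = dim R` elements and
`I^{n+1} = J I^n` for `n ≫ 0`. -/
def IsMinimalReduction [CommRing R] (d : ℕ) (J I : Ideal R) : Prop :=
  J ≤ I ∧ (∃ s : Fin d → R, J = Ideal.span (Set.range s)) ∧
    ∃ N : ℕ, ∀ n ≥ N, I ^ (n + 1) = J * I ^ n

/-- Normal Hilbert data: `L n = λ(R/ intCl(I^{n+1}))` and for `n ≫ 0` this agrees
with the polynomial whose normalized coefficients are the `e i`. -/
def NormalHilbertData [CommRing R] (d : ℕ) (I : Ideal R) (L : ℕ → ℕ) (e : ℕ → ℤ) : Prop :=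
  (∀ n, mlen R (R ⧸ intCl (I ^ (n + 1))) = (L n : WithBot ℕ∞)) ∧
    ∃ N : ℕ, ∀ n ≥ N, (L n : ℤ) =
      ∑ i ∈ Finset.range (d + 1), (-1 : ℤ) ^ i * e i * ((n + d - i).choose (d - i))

/-- `t` is the Cohen-Macaulay type of the local ring `R` of dimension `d`:
`t = λ((Q : m)/Q)` for every ideal `Q` generated by a maximal regular sequence in `m`. -/
def CMTypeData (R : Type*) [CommRing R] [IsLocalRing R] (d t : ℕ) : Prop :=
  ∀ s : List R, s.length = d → (∀ x ∈ s, x ∈ maximalIdeal R) →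
    RingTheory.Sequence.IsRegular R s →
      mlen R (idealQuot ((Ideal.span {x | x ∈ s}).colon (maximalIdeal R))
        (Ideal.span {x | x ∈ s})) = (t : WithBot ℕ∞)

/-- The quotient module `N/(K ∩ N)` for submodules `N K` of a module. -/
abbrev submoduleQuot {A M : Type*} [CommRing A] [AddCommGroup M] [Module A M]
    (N K : Submodule A M) :=
  N ⧸ (Submodule.comap N.subtype K)

section SallyAux

/-- `x` is a nonzerodivisor modulo `Q`. -/
def SallyNzd [CommRing R] (Q : Ideal R) (x : R) : Prop := ∀ a, x * a ∈ Q → a ∈ Q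

/-- There is a weakly regular sequence of length `n` modulo `Q` inside `m`. -/
def SallyG [CommRing R] (m : Ideal R) : ℕ → Ideal R → Prop
  | 0, _ => True
  | n + 1, Q => ∃ x ∈ m, SallyNzd Q x ∧ SallyG m n (Q ⊔ Ideal.span {x})

/-- `J` is generated by a weakly regular sequence of length `d`. -/
inductive SallyReg [CommRing R] : ℕ → Ideal R → Prop
  | zero : SallyReg 0 ⊥
  | succ (d : ℕ) (Q : Ideal R) (t : R) : SallyReg d Q → SallyNzd Q t →
      SallyReg (d + 1) (Q ⊔ Ideal.span {t})

lemma sally_mem_sup [CommRing R] {Q : Ideal R} {x a : R} :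
    a ∈ Q ⊔ Ideal.span {x} ↔ ∃ q ∈ Q, ∃ b, a = q + x * b := by
  rw [Submodule.mem_sup]
  constructor
  · rintro ⟨q, hq, z, hz, rfl⟩
    obtain ⟨b, rfl⟩ := Ideal.mem_span_singleton'.1 hz
    exact ⟨q, hq, b, by ring⟩
  · rintro ⟨q, hq, b, rfl⟩
    exact ⟨q, hq, x * b, Ideal.mul_mem_right _ _ (Ideal.mem_span_singleton_self x), rfl⟩

lemma sally_avoid [CommRing R] [IsNoetherianRing R] (J B Q₁ Q₂ : Ideal R)
    (h₁ : ∀ a ∉ Q₁, ∃ w ∈ J, w * a ∉ Q₁) (h₂ : ∀ a ∉ Q₂, ∃ w ∈ J, w * a ∉ Q₂) :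
    ∃ z ∈ J, (J ≤ B ∨ z ∉ B) ∧ SallyNzd Q₁ z ∧ SallyNzd Q₂ z := by
  classical
  have key : ∀ Q : Ideal R, (∀ a ∉ Q, ∃ w ∈ J, w * a ∉ Q) →
      ∀ P ∈ associatedPrimes R (R ⧸ Q), ¬ J ≤ P := by
    intro Q h P hP hJP
    rw [AssociatedPrimes.mem_iff, isAssociatedPrime_iff] at hP
    obtain ⟨hprime, x, rfl⟩ := hP
    obtain ⟨a, rfl⟩ := Ideal.Quotient.mk_surjective x
    have ha : a ∉ Q := by
      intro ha
      apply hprime.ne_top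
      rw [Ideal.Quotient.eq_zero_iff_mem.2 ha]
      simp
    obtain ⟨w, hw, hwa⟩ := h a ha
    have := hJP hw
    rw [Submodule.mem_colon_singleton, Submodule.mem_bot, ← Ideal.Quotient.mk_eq_mk,
      ← Submodule.Quotient.mk_smul, Submodule.Quotient.mk_eq_zero] at this
    exact hwa this
  have key2 : ∀ (Q : Ideal R) (z : R), (∀ P ∈ associatedPrimes R (R ⧸ Q), z ∉ P) →
      SallyNzd Q z := by
    intro Q z hz a hza
    by_contra ha
    have hx : (Ideal.Quotient.mk Q a) ≠ 0 := by
      rwa [Ne, Ideal.Quotient.eq_zero_iff_mem]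
    obtain ⟨P, hP, hle⟩ := exists_le_isAssociatedPrime_of_isNoetherianRing R _ hx
    refine hz P hP (hle ?_)
    rw [Submodule.mem_colon_singleton, Submodule.mem_bot, ← Ideal.Quotient.mk_eq_mk,
      ← Submodule.Quotient.mk_smul, Submodule.Quotient.mk_eq_zero]
    exact hza
  have f₁ := associatedPrimes.finite R (R ⧸ Q₁)
  have f₂ := associatedPrimes.finite R (R ⧸ Q₂)
  let s : Finset (Ideal R) := (f₁.toFinset ∪ f₂.toFinset) ∪ (if J ≤ B then ∅ else {B})
  have hno : ¬ ((J : Set R) ⊆ ⋃ i ∈ (↑s : Set (Ideal R)), ((id i : Ideal R) : Set R)) := by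
    rw [Ideal.subset_union_prime B B]
    · rintro ⟨P, hP, hJP⟩
      simp only [s, Finset.mem_union, Set.Finite.mem_toFinset] at hP
      rcases hP with (hP | hP) | hP
      · exact key _ h₁ _ hP hJP
      · exact key _ h₂ _ hP hJP
      · split_ifs at hP with hB
        · simp at hP
        · rw [Finset.mem_singleton] at hP
          subst hP
          exact hB hJP
    · intro P hP hPB _
      simp only [s, Finset.mem_union, Set.Finite.mem_toFinset] at hP
      rcases hP with (hP | hP) | hP
      · exact hP.1
      · exact hP.1
      · split_ifs at hP with hB
        · simp at hP
        · exact absurd (Finset.mem_singleton.1 hP) hPB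
  obtain ⟨z, hz, hz'⟩ := Set.not_subset.1 hno
  simp only [Set.mem_iUnion, not_exists, id] at hz'
  refine ⟨z, hz, ?_, key2 _ _ ?_, key2 _ _ ?_⟩
  · by_cases hB : J ≤ B
    · exact Or.inl hB
    · exact Or.inr (hz' B (by simp [s, hB]))
  · exact fun P hP => hz' P (by simp [s, hP])
  · exact fun P hP => hz' P (by simp [s, hP])

lemma sally_swap [CommRing R] {Q : Ideal R} {x z : R} (hx : SallyNzd Q x)
    (hz : SallyNzd (Q ⊔ Ideal.span {x}) z) : SallyNzd (Q ⊔ Ideal.span {z}) x := by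
  intro a ha
  obtain ⟨j, hj, b, hb⟩ := sally_mem_sup.1 ha
  have : z * b ∈ Q ⊔ Ideal.span {x} :=
    sally_mem_sup.2 ⟨-j, neg_mem hj, a, by rw [hb]; ring⟩
  obtain ⟨j', hj', c, hc⟩ := sally_mem_sup.1 (hz b this)
  have h2 : x * (a - z * c) ∈ Q := by
    have : x * (a - z * c) = j + z * j' := by rw [mul_sub, hb, hc]; ring
    rw [this]
    exact add_mem hj (Ideal.mul_mem_left _ _ hj')
  exact sally_mem_sup.2 ⟨_, hx _ h2, c, by ring⟩

lemma sally_first [CommRing R] [IsLocalRing R] [IsNoetherianRing R] {Q : Ideal R} {x z : R}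
    (hxm : x ∈ maximalIdeal R) (hx : SallyNzd Q x)
    (hz : SallyNzd (Q ⊔ Ideal.span {x}) z) : SallyNzd Q z := by
  let N : Ideal R := Submodule.comap (LinearMap.mulLeft R z) Q
  have hN : ∀ a, a ∈ N ↔ z * a ∈ Q := fun a => Iff.rfl
  have : N ≤ Q := by
    apply Submodule.le_of_le_smul_of_le_jacobson_bot (I := maximalIdeal R)
      (IsNoetherian.noetherian _) (IsLocalRing.jacobson_eq_maximalIdeal _ bot_ne_top).ge
    intro a ha
    obtain ⟨j, hj, b, rfl⟩ := sally_mem_sup.1 (hz a (Ideal.mem_sup_left ((hN a).1 ha)))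
    have hb : b ∈ N := by
      rw [hN]
      apply hx
      have : x * (z * b) = z * (j + x * b) - z * j := by ring
      rw [this]
      exact sub_mem ((hN _).1 ha) (Ideal.mul_mem_left _ _ hj)
    exact add_mem (Ideal.mem_sup_left hj) (Ideal.mem_sup_right (Ideal.mul_mem_mul hxm hb))
  exact fun a ha => this ((hN a).2 ha)

lemma sally_exchange [CommRing R] [IsLocalRing R] [IsNoetherianRing R] (n : ℕ) :
    ∀ (Q : Ideal R) (y : R), y ∈ maximalIdeal R → SallyNzd Q y →
      SallyG (maximalIdeal R) (n + 1) Q → SallyG (maximalIdeal R) n (Q ⊔ Ideal.span {y}) := by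
  induction n with
  | zero => intros; trivial
  | succ n ih =>
    rintro Q y hym hy ⟨x, hxm, hx, hG⟩
    obtain ⟨z₀, hz₀m, hz₀, -⟩ := id hG
    obtain ⟨z, hzm, -, hzx, hzy⟩ := sally_avoid (maximalIdeal R) ⊥ (Q ⊔ Ideal.span {x})
      (Q ⊔ Ideal.span {y}) (fun a ha => ⟨z₀, hz₀m, fun h => ha (hz₀ a h)⟩) (by
        intro a ha
        by_contra hcon
        push Not at hcon
        obtain ⟨j, hj, b, hb⟩ := sally_mem_sup.1 (hcon x hxm)
        have hbx : z₀ * b ∈ Q ⊔ Ideal.span {x} := by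
          obtain ⟨j', hj', c, hc⟩ := sally_mem_sup.1 (hcon z₀ hz₀m)
          have : y * (z₀ * b - x * c) ∈ Q := by
            have : y * (z₀ * b - x * c) = x * j' - z₀ * j := by
              linear_combination (-z₀) * hb + x * hc
            rw [this]
            exact sub_mem (Ideal.mul_mem_left _ _ hj') (Ideal.mul_mem_left _ _ hj)
          exact sally_mem_sup.2 ⟨_, hy _ this, c, by ring⟩
        obtain ⟨j'', hj'', c, hc⟩ := sally_mem_sup.1 (hz₀ b hbx)
        have : x * (a - y * c) ∈ Q := by
          have : x * (a - y * c) = j + y * j'' := by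
            rw [mul_sub, hb, hc]; ring
          rw [this]
          exact add_mem hj (Ideal.mul_mem_left _ _ hj'')
        exact ha (sally_mem_sup.2 ⟨_, hx _ this, c, by ring⟩))
    have g1 := ih _ z hzm hzx hG
    have g2 : SallyG (maximalIdeal R) (n + 1) (Q ⊔ Ideal.span {z}) :=
      ⟨x, hxm, sally_swap hx hzx, by rwa [sup_right_comm]⟩
    have g3 := ih _ y hym (sally_swap hy hzy) g2
    exact ⟨z, hzm, hzy, by rwa [sup_right_comm]⟩

lemma sally_build [CommRing R] [IsLocalRing R] [IsNoetherianRing R] (J : Ideal R)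
    (hJ : J.radical = maximalIdeal R) (n : ℕ) :
    ∀ (k : ℕ) (Q : Ideal R) (s : Fin n → R), SallyReg k Q →
      J = Q ⊔ Ideal.span (Set.range s) →
      SallyG (maximalIdeal R) n Q → SallyReg (k + n) J := by
  induction n with
  | zero =>
    intro k Q s hQ hJQ _
    simp only [Set.range_eq_empty, Ideal.span_empty, sup_bot_eq] at hJQ
    rw [hJQ]
    exact hQ
  | succ n ih =>
    intro k Q s hQ hJQ hG
    have hJm : J ≤ maximalIdeal R := hJ ▸ Ideal.le_radical
    have hQJ : Q ≤ J := hJQ ▸ le_sup_left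
    obtain ⟨x, hxm, hx, -⟩ := id hG
    have hpow : ∀ i a, x ^ i * a ∈ Q → a ∈ Q := by
      intro i
      induction i with
      | zero => intro a ha; simpa using ha
      | succ i hi =>
        intro a ha
        exact hx _ (hi _ (by rwa [pow_succ, mul_assoc] at ha))
    obtain ⟨i, hi⟩ : x ∈ J.radical := hJ ▸ hxm
    have h1 : ∀ a ∉ Q, ∃ w ∈ J, w * a ∉ Q := fun a ha => ⟨x ^ i, hi, fun h => ha (hpow i a h)⟩
    obtain ⟨t, htJ, htB, ht, -⟩ := sally_avoid J (Q ⊔ maximalIdeal R * J) Q Q h1 h1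
    have htB' : t ∉ Q ⊔ maximalIdeal R * J := by
      rcases htB with h | h
      · exfalso
        have hle : J ≤ Q := Submodule.le_of_le_smul_of_le_jacobson_bot (I := maximalIdeal R)
          (IsNoetherian.noetherian _) (IsLocalRing.jacobson_eq_maximalIdeal _ bot_ne_top).ge h
        have : (1 : R) ∈ Q := hpow i 1 (by simpa using hle hi)
        exact (Ideal.ne_top_iff_one _).1 (IsLocalRing.maximalIdeal.isMaximal R).ne_top
          (hJm (hQJ this))
      · exact h
    have hG' := sally_exchange n Q t (hJm htJ) ht hG
    have htJ' := htJ
    rw [hJQ] at htJ'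
    obtain ⟨q, hq, u, hu, hqu⟩ := Submodule.mem_sup.1 htJ'
    obtain ⟨c, hc⟩ := (Ideal.mem_span_range_iff_exists_fun).1 hu
    have hs : ∀ j, s j ∈ J := fun j => hJQ ▸ Ideal.mem_sup_right (Ideal.subset_span ⟨j, rfl⟩)
    obtain ⟨j, hj⟩ : ∃ j, IsUnit (c j) := by
      by_contra hcon
      push Not at hcon
      apply htB'
      rw [← hqu, ← hc]
      refine add_mem (Ideal.mem_sup_left hq) (Ideal.mem_sup_right (sum_mem fun j _ => ?_))
      exact Ideal.mul_mem_mul ((IsLocalRing.mem_maximalIdeal _).2 (hcon j)) (hs j)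
    have := ih (k + 1) (Q ⊔ Ideal.span {t}) (fun l => s (j.succAbove l)) (.succ k Q t hQ ht) (by
      apply le_antisymm
      · have hmem : ∀ l, s (j.succAbove l) ∈ Q ⊔ Ideal.span {t} ⊔
            Ideal.span (Set.range fun l => s (j.succAbove l)) :=
          fun l => Ideal.mem_sup_right (Ideal.subset_span ⟨l, rfl⟩)
        have htm : t ∈ Q ⊔ Ideal.span {t} ⊔
            Ideal.span (Set.range fun l => s (j.succAbove l)) :=
          Ideal.mem_sup_left (Ideal.mem_sup_right (Ideal.mem_span_singleton_self t))
        have hqm := fun q (hq : q ∈ Q) => (Ideal.mem_sup_left (Ideal.mem_sup_left hq) :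
          q ∈ Q ⊔ Ideal.span {t} ⊔ Ideal.span (Set.range fun l => s (j.succAbove l)))
        conv_lhs => rw [hJQ]
        refine sup_le (fun q hq => hqm q hq) (Ideal.span_le.2 ?_)
        rintro _ ⟨l, rfl⟩
        by_cases hl : l = j
        · subst hl
          rw [Fin.sum_univ_succAbove _ l] at hc
          have : c l * s l = t - q - ∑ i, c (l.succAbove i) * s (l.succAbove i) := by
            rw [← hqu, ← hc]; ring
          refine (Ideal.unit_mul_mem_iff_mem _ hj).1 ?_
          rw [this]
          exact sub_mem (sub_mem htm (hqm q hq)) (sum_mem fun i _ => Ideal.mul_mem_left _ _ (hmem i))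
        · obtain ⟨l', rfl⟩ := Fin.exists_succAbove_eq hl
          exact hmem l'
      · refine sup_le (sup_le hQJ ?_) (Ideal.span_le.2 ?_)
        · rwa [Ideal.span_singleton_le_iff_mem]
        · rintro _ ⟨l, rfl⟩
          exact hs _) hG'
    have e : k + (n + 1) = k + 1 + n := by ring
    rwa [e]

lemma sally_G_of_list [CommRing R] (m : Ideal R) (rs : List R) (hm : ∀ x ∈ rs, x ∈ m)
    (h : RingTheory.Sequence.IsWeaklyRegular R rs) (n : ℕ) :
    ∀ i, i + n ≤ rs.length → SallyG m n (Ideal.ofList (rs.take i)) := by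
  induction n with
  | zero => intros; trivial
  | succ n ih =>
    intro i hi
    have hi' : i < rs.length := by omega
    refine ⟨rs[i], hm _ (List.getElem_mem hi'), ?_, ?_⟩
    · intro a ha
      have := h.regular_mod_prev i hi'
      have h2 : (rs[i]) • (Submodule.Quotient.mk a :
          R ⧸ (Ideal.ofList (rs.take i) • ⊤ : Submodule R R)) = rs[i] • 0 := by
        rw [smul_zero, ← Submodule.Quotient.mk_smul, Submodule.Quotient.mk_eq_zero]
        simpa using ha
      have h3 := this h2
      rw [Submodule.Quotient.mk_eq_zero] at h3
      simpa using h3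
    · have := ih (i + 1) (by omega)
      rw [List.take_succ_eq_append_getElem hi', Ideal.ofList_append, Ideal.ofList_singleton] at this
      exact this

lemma sally_mul_left [CommRing R] {A B : Ideal R} {a : R} (h : a ∈ A * B) : a ∈ A :=
  (Ideal.mul_le_inf h).1

lemma sally_pow_mul [CommRing R] (Q T K : Ideal R) (n : ℕ) :
    (Q ⊔ T) ^ (n + 1) * K = Q ^ (n + 1) * K ⊔ T * ((Q ⊔ T) ^ n * K) := by
  have h : (Q ⊔ T) ^ (n + 1) = Q ^ (n + 1) ⊔ T * (Q ⊔ T) ^ n := by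
    induction n with
    | zero => simp
    | succ n ih =>
      apply le_antisymm
      · rw [pow_succ' (Q ⊔ T) (n + 1), Ideal.sup_mul]
        refine sup_le ?_ le_sup_right
        rw [ih, Ideal.mul_sup, ← pow_succ']
        refine sup_le_sup le_rfl ?_
        rw [mul_left_comm]
        refine Ideal.mul_mono le_rfl ?_
        rw [← ih, pow_succ']
        exact Ideal.mul_mono le_sup_left le_rfl
      · refine sup_le (Ideal.pow_right_mono le_sup_left _) ?_
        rw [pow_succ' (Q ⊔ T) (n + 1)]
        exact Ideal.mul_mono le_sup_right le_rfl
  rw [h, Ideal.sup_mul, mul_assoc]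

lemma sally_mem_pow_mul [CommRing R] {Q K : Ideal R} {t a : R} {n : ℕ} :
    a ∈ (Q ⊔ Ideal.span {t}) ^ (n + 1) * K ↔
      ∃ u ∈ Q ^ (n + 1) * K, ∃ v ∈ (Q ⊔ Ideal.span {t}) ^ n * K, a = u + t * v := by
  rw [sally_pow_mul, Submodule.mem_sup]
  constructor
  · rintro ⟨u, hu, w, hw, rfl⟩
    obtain ⟨v, hv, rfl⟩ := Ideal.mem_span_singleton_mul.1 hw
    exact ⟨u, hu, v, hv, rfl⟩
  · rintro ⟨u, hu, v, hv, rfl⟩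
    exact ⟨u, hu, _, Ideal.mem_span_singleton_mul.2 ⟨v, hv, rfl⟩, rfl⟩

lemma sally_mem_pow [CommRing R] {Q : Ideal R} {t a : R} {n : ℕ} :
    a ∈ (Q ⊔ Ideal.span {t}) ^ (n + 1) ↔
      ∃ u ∈ Q ^ (n + 1), ∃ v ∈ (Q ⊔ Ideal.span {t}) ^ n, a = u + t * v := by
  simpa using sally_mem_pow_mul (Q := Q) (K := ⊤) (t := t) (a := a) (n := n)

lemma sally_E1 [CommRing R] {Q K : Ideal R} {t : R} (ht : ∀ j, SallyNzd (Q ^ j) t)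
    (htK : t ∈ K) {n : ℕ} {a u v : R} (ha : a ∈ Q ^ n) (hu : u ∈ Q ^ n * K)
    (h : a = u + t * v) : a ∈ Q ^ n * K := by
  have h1 : t * v ∈ Q ^ n := by
    have : t * v = a - u := by rw [h]; ring
    rw [this]
    exact sub_mem ha (sally_mul_left hu)
  rw [h, mul_comm t]
  exact add_mem hu (Ideal.mul_mem_mul (ht n v h1) htK)

lemma sally_E2 [CommRing R] {Q K : Ideal R} {t : R} (ht : ∀ j, SallyNzd (Q ^ j) t)
    (hK : Q ⊔ Ideal.span {t} ≤ K) {n : ℕ} {a : R}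
    (h : t * a ∈ (Q ⊔ Ideal.span {t}) ^ (n + 1) * K) : a ∈ (Q ⊔ Ideal.span {t}) ^ n * K := by
  obtain ⟨u, hu, v, hv, h⟩ := sally_mem_pow_mul.1 h
  have h1 : t * (a - v) ∈ Q ^ (n + 1) := by
    rw [mul_sub, h, add_sub_cancel_right]
    exact sally_mul_left hu
  have h2 := ht _ _ h1
  have h3 : a - v ∈ (Q ⊔ Ideal.span {t}) ^ n * K := by
    rw [pow_succ] at h2
    exact Ideal.mul_mono (Ideal.pow_right_mono le_sup_left n) (le_sup_left.trans hK) h2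
  simpa using add_mem h3 hv

lemma sally_nzd_pow [CommRing R] {Q : Ideal R}
    (h : ∀ K, Q ≤ K → ∀ x, SallyNzd K x → ∀ n, ∀ a ∈ Q ^ n, x * a ∈ Q ^ n * K → a ∈ Q ^ n * K)
    {t : R} (ht : SallyNzd Q t) (j : ℕ) : SallyNzd (Q ^ j) t := by
  induction j with
  | zero => intro a _; simp
  | succ j ih =>
    intro a ha
    rw [pow_succ] at ha ⊢
    exact h Q le_rfl t ht j a (ih a (sally_mul_left ha)) ha

lemma sally_Q [CommRing R] {d : ℕ} {J : Ideal R} (hJ : SallyReg d J) :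
    ∀ K, J ≤ K → ∀ x, SallyNzd K x → ∀ n, ∀ a ∈ J ^ n, x * a ∈ J ^ n * K → a ∈ J ^ n * K := by
  induction hJ with
  | zero =>
    intro K _ x hx n a ha hxa
    cases n with
    | zero =>
      simp only [pow_zero, Ideal.one_eq_top, Ideal.top_mul] at hxa ⊢
      exact hx a hxa
    | succ n =>
      have : a = 0 := by simpa [pow_succ] using ha
      rw [this]
      exact zero_mem _
  | succ d Q t hQ ht ih =>
    intro K hK x hx n
    have hT := sally_nzd_pow ih ht
    have htK : t ∈ K := hK (Ideal.mem_sup_right (Ideal.mem_span_singleton_self t))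
    induction n with
    | zero =>
      intro a ha hxa
      simp only [pow_zero, Ideal.one_eq_top, Ideal.top_mul] at hxa ⊢
      exact hx a hxa
    | succ n ihn =>
      intro a ha hxa
      obtain ⟨a0, ha0, b, hb, rfl⟩ := sally_mem_pow.1 ha
      have h0 : a0 ∈ Q ^ (n + 1) * K := by
        refine ih K (le_sup_left.trans hK) x hx (n + 1) a0 ha0 ?_
        obtain ⟨u, hu, v, hv, h⟩ := sally_mem_pow_mul.1 hxa
        refine sally_E1 hT htK (Ideal.mul_mem_left _ x ha0) hu (v := v - x * b) ?_
        linear_combination h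
      have h0' : a0 ∈ (Q ⊔ Ideal.span {t}) ^ (n + 1) * K :=
        Ideal.mul_mono (Ideal.pow_right_mono le_sup_left _) le_rfl h0
      have h1 : t * (x * b) ∈ (Q ⊔ Ideal.span {t}) ^ (n + 1) * K := by
        have : t * (x * b) = x * (a0 + t * b) - x * a0 := by ring
        rw [this]
        exact sub_mem hxa (Ideal.mul_mem_left _ x h0')
      have h2 := ihn b hb (sally_E2 hT hK h1)
      exact sally_mem_pow_mul.2 ⟨a0, h0, b, h2, rfl⟩

/-- length of `A/(B ∩ A)` -/
noncomputable def sallyLen [CommRing R] (A B : Ideal R) : ℕ∞ := Module.length R (idealQuot A B)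

lemma sallyLen_congr [CommRing R] (f : R →ₗ[R] R) (A A' B B' : Ideal R)
    (h1 : ∀ b ∈ B, ∃ a ∈ A, b - f a ∈ B') (h2 : ∀ a ∈ A, f a ∈ B)
    (h3 : ∀ a ∈ A, f a ∈ B' ↔ a ∈ A') : sallyLen A A' = sallyLen B B' := by
  let g : A →ₗ[R] B := f.restrict h2
  let g' : A →ₗ[R] idealQuot B B' := (Submodule.mkQ _) ∘ₗ g
  have hsurj : Function.Surjective g' := by
    intro y
    obtain ⟨⟨b, hb⟩, rfl⟩ := Submodule.mkQ_surjective _ y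
    obtain ⟨a, ha, hab⟩ := h1 b hb
    refine ⟨⟨a, ha⟩, ?_⟩
    symm
    change Submodule.Quotient.mk _ = Submodule.Quotient.mk _
    rw [Submodule.Quotient.eq]
    exact hab
  have hker : LinearMap.ker g' = Submodule.comap A.subtype A' := by
    ext ⟨a, ha⟩
    rw [LinearMap.mem_ker]
    change Submodule.Quotient.mk _ = (0 : idealQuot B B') ↔ _
    rw [Submodule.Quotient.mk_eq_zero]
    exact h3 a ha
  exact ((Submodule.quotEquivOfEq _ _ hker.symm).trans
    (g'.quotKerEquivOfSurjective hsurj)).length_eq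

lemma sallyLen_add [CommRing R] (A B C : Ideal R) (hBA : B ≤ A) (hCB : C ≤ B) :
    sallyLen A C = sallyLen B C + sallyLen A B := by
  have hle1 : Submodule.comap B.subtype C ≤
      Submodule.comap (Submodule.inclusion hBA) (Submodule.comap A.subtype C) := fun x hx => hx
  have hle2 : Submodule.comap A.subtype C ≤
      Submodule.comap LinearMap.id (Submodule.comap A.subtype B) := fun x hx => hCB hx
  refine Module.length_eq_add_of_exact
    (Submodule.mapQ (Submodule.comap B.subtype C) (Submodule.comap A.subtype C)
      (Submodule.inclusion hBA) hle1)
    (Submodule.mapQ (Submodule.comap A.subtype C) (Submodule.comap A.subtype B)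
      LinearMap.id hle2) ?_ ?_ ?_
  · rw [← LinearMap.ker_eq_bot, LinearMap.ker_eq_bot']
    intro y hy
    obtain ⟨b, rfl⟩ := Submodule.mkQ_surjective _ y
    rw [Submodule.mkQ_apply, Submodule.mapQ_apply, Submodule.Quotient.mk_eq_zero] at hy
    rw [Submodule.mkQ_apply, Submodule.Quotient.mk_eq_zero]
    exact hy
  · intro y
    obtain ⟨b, rfl⟩ := Submodule.mkQ_surjective _ y
    exact ⟨Submodule.Quotient.mk b, rfl⟩
  · intro y
    obtain ⟨⟨a, ha⟩, rfl⟩ := Submodule.mkQ_surjective _ y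
    rw [Submodule.mkQ_apply, Submodule.mapQ_apply, Submodule.Quotient.mk_eq_zero]
    constructor
    · intro h
      exact ⟨Submodule.Quotient.mk ⟨a, h⟩, rfl⟩
    · rintro ⟨z, hz⟩
      obtain ⟨b, rfl⟩ := Submodule.mkQ_surjective _ z
      rw [Submodule.mkQ_apply, Submodule.mapQ_apply, Submodule.Quotient.eq] at hz
      have h4 : (b : R) - a ∈ C := hz
      have := sub_mem b.2 (hCB h4)
      simpa using this

lemma sallyLen_self [CommRing R] (A B : Ideal R) (h : A ≤ B) : sallyLen A B = 0 := by
  have : Subsingleton (idealQuot A B) := by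
    rw [Submodule.Quotient.subsingleton_iff]
    exact eq_top_iff.2 fun x _ => h x.2
  exact Module.length_eq_zero

lemma sallyLen_top [CommRing R] (K : Ideal R) : sallyLen ⊤ K = Module.length R (R ⧸ K) :=
  (Submodule.Quotient.equiv _ _ (Submodule.topEquiv (R := R) (M := R)) (by
    ext x
    simp)).length_eq

lemma sallyLen_pow [CommRing R] {d : ℕ} {J : Ideal R} (hJ : SallyReg d J) :
    ∀ K, J ≤ K → ∀ n, sallyLen (J ^ n) (J ^ n * K) = ((n + d - 1).choose n : ℕ) * sallyLen ⊤ K := by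
  induction hJ with
  | zero =>
    intro K _ n
    cases n with
    | zero => simp
    | succ n =>
      rw [sallyLen_self _ _ (by rw [pow_succ, Ideal.mul_bot]; exact bot_le)]
      simp
  | succ d Q t hQ ht ih =>
    intro K hK n
    have hT := sally_nzd_pow (sally_Q hQ) ht
    have htK : t ∈ K := hK (Ideal.mem_sup_right (Ideal.mem_span_singleton_self t))
    set J := Q ⊔ Ideal.span {t} with hJ
    induction n with
    | zero => simp
    | succ n ihn =>
      let M : Ideal R := J ^ (n + 1) * K ⊔ Ideal.span {t} * J ^ n
      have hM : ∀ a, a ∈ M ↔ ∃ u ∈ Q ^ (n + 1) * K, ∃ v ∈ J ^ n, a = u + t * v := by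
        intro a
        rw [Submodule.mem_sup]
        constructor
        · rintro ⟨y, hy, z, hz, rfl⟩
          obtain ⟨u, hu, v, hv, rfl⟩ := sally_mem_pow_mul.1 hy
          obtain ⟨w, hw, rfl⟩ := Ideal.mem_span_singleton_mul.1 hz
          exact ⟨u, hu, v + w, add_mem (sally_mul_left hv) hw, by ring⟩
        · rintro ⟨u, hu, v, hv, rfl⟩
          exact ⟨u, Ideal.mul_mono (Ideal.pow_right_mono le_sup_left _) le_rfl hu, _,
            Ideal.mem_span_singleton_mul.2 ⟨v, hv, rfl⟩, rfl⟩
      have hMle : M ≤ J ^ (n + 1) := by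
        refine sup_le (fun _ h => sally_mul_left h) ?_
        rw [pow_succ']
        exact Ideal.mul_mono le_sup_right le_rfl
      rw [sallyLen_add _ M _ hMle le_sup_left]
      have e1 : sallyLen (J ^ n) (J ^ n * K) = sallyLen M (J ^ (n + 1) * K) := by
        refine sallyLen_congr (LinearMap.mulLeft R t) _ _ _ _ ?_ ?_ ?_
        · intro b hb
          obtain ⟨u, hu, v, hv, rfl⟩ := (hM b).1 hb
          refine ⟨v, hv, ?_⟩
          simpa using Ideal.mul_mono (Ideal.pow_right_mono le_sup_left _) le_rfl hu
        · intro a ha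
          exact (hM _).2 ⟨0, zero_mem _, a, ha, by simp⟩
        · intro a ha
          constructor
          · intro h
            exact sally_E2 hT hK h
          · intro h
            exact sally_mem_pow_mul.2 ⟨0, zero_mem _, a, h, by simp⟩
      have e2 : sallyLen (Q ^ (n + 1)) (Q ^ (n + 1) * K) = sallyLen (J ^ (n + 1)) M := by
        refine sallyLen_congr LinearMap.id _ _ _ _ ?_ ?_ ?_
        · intro b hb
          obtain ⟨u, hu, v, hv, rfl⟩ := sally_mem_pow.1 hb
          exact ⟨u, hu, (hM _).2 ⟨0, zero_mem _, v, hv, by simp⟩⟩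
        · intro a ha
          exact Ideal.pow_right_mono le_sup_left _ ha
        · intro a ha
          constructor
          · intro h
            obtain ⟨u, hu, v, hv, h⟩ := (hM _).1 h
            exact sally_E1 hT htK ha hu h
          · intro h
            exact (hM _).2 ⟨a, h, 0, zero_mem _, by simp⟩
      rw [← e1, ← e2, ihn, ih K (le_sup_left.trans hK), ← add_mul, ← Nat.cast_add]
      have h1 : n + (d + 1) - 1 = n + d := by omega
      have h2 : n + 1 + d - 1 = n + d := by omega
      have h3 : n + 1 + (d + 1) - 1 = n + d + 1 := by omega
      rw [h1, h2, h3, Nat.choose_succ_succ]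

lemma sallyLen_top_pow [CommRing R] {d : ℕ} {J : Ideal R} (hJ : SallyReg (d + 1) J) (n : ℕ) :
    sallyLen ⊤ (J ^ n) = ((n + d).choose (d + 1) : ℕ) * sallyLen ⊤ J := by
  induction n with
  | zero =>
    rw [sallyLen_self _ _ (by simp)]
    simp
  | succ n ih =>
    rw [sallyLen_add ⊤ (J ^ n) _ le_top (Ideal.pow_le_pow_right n.le_succ), ih, pow_succ,
      sallyLen_pow hJ J le_rfl, ← add_mul, ← Nat.cast_add]
    have h1 : n + (d + 1) - 1 = n + d := by omega
    have h2 : n + 1 + d = n + d + 1 := by omega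
    rw [h1, h2, Nat.choose_succ_succ, Nat.choose_symm_add]

lemma sally_uniq (d : ℕ) : ∀ (b : ℕ → ℤ) (N : ℕ),
    (∀ n ≥ N, ∑ j ∈ Finset.range (d + 1), b j * ((n + j).choose j : ℕ) = 0) →
    ∀ j ≤ d, b j = 0 := by
  induction d with
  | zero =>
    intro b N h j hj
    have := h N le_rfl
    obtain rfl : j = 0 := by omega
    simpa using this
  | succ d ih =>
    intro b N h j hj
    have h' : ∀ j ≤ d, b (j + 1) = 0 := by
      refine ih (fun j => b (j + 1)) (N + 1) ?_
      intro n hn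
      obtain ⟨n, rfl⟩ : ∃ k, n = k + 1 := ⟨n - 1, by omega⟩
      have e1 := h (n + 1) (by omega)
      have e2 := h n (by omega)
      rw [Finset.sum_range_succ'] at e1 e2
      have e3 : ∑ j ∈ Finset.range (d + 1), b (j + 1) * ((n + 1 + j).choose j : ℕ) =
          ∑ j ∈ Finset.range (d + 1), b (j + 1) * ((n + 1 + (j + 1)).choose (j + 1) : ℕ) -
          ∑ j ∈ Finset.range (d + 1), b (j + 1) * ((n + (j + 1)).choose (j + 1) : ℕ) := by
        rw [← Finset.sum_sub_distrib]
        refine Finset.sum_congr rfl fun j _ => ?_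
        have h1 : n + 1 + (j + 1) = (n + 1 + j) + 1 := by ring
        have h2 : n + (j + 1) = n + 1 + j := by ring
        rw [h1, h2, Nat.choose_succ_succ]
        push_cast
        ring
      rw [e3]
      simp only [Nat.choose_zero_right] at e1 e2
      linarith
    rcases j with _ | j
    · have := h N le_rfl
      rw [Finset.sum_range_succ', Finset.sum_eq_zero] at this
      · simpa using this
      · intro j hj
        rw [h' j (by simpa [Nat.lt_succ_iff] using hj), zero_mul]
    · exact h' j (by omega)

lemma sally_le_intCl [CommRing R] (I : Ideal R) : I ≤ intCl I := by
  intro x hx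
  refine Ideal.subset_span ⟨1, one_pos, fun _ => -x, ?_, ?_⟩
  · intro i hi
    obtain rfl : i = 1 := by simpa using hi
    simpa using hx
  · simp

lemma sally_mul_le [CommRing R] (I J : Ideal R) (h : J ≤ I) (n : ℕ) :
    J ^ n * intCl I ≤ intCl (I ^ (n + 1)) := by
  rw [intCl, Ideal.mul_le]
  intro y hy x hx
  have hy' := Ideal.pow_right_mono h n hy
  induction hx using Submodule.span_induction with
  | zero => simp
  | add a b _ _ ha hb => rw [mul_add]; exact add_mem ha hb
  | smul c a _ ha =>
    rw [smul_eq_mul, mul_left_comm]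
    exact Ideal.mul_mem_left _ _ ha
  | mem x hx =>
    obtain ⟨k, hk, a, ha, hsum⟩ := hx
    refine Ideal.subset_span ⟨k, hk, fun i => a i * y ^ i, ?_, ?_⟩
    · intro i hi
      have : (I ^ (n + 1)) ^ i = I ^ i * (I ^ n) ^ i := by
        rw [← mul_pow, ← pow_succ']
      rw [this]
      exact Ideal.mul_mem_mul (ha i hi) (Ideal.pow_mem_pow hy' i)
    · have : (y * x) ^ k + ∑ i ∈ Finset.Icc 1 k, a i * y ^ i * (y * x) ^ (k - i) =
          y ^ k * (x ^ k + ∑ i ∈ Finset.Icc 1 k, a i * x ^ (k - i)) := by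
        rw [mul_add, mul_pow, Finset.mul_sum]
        congr 1
        refine Finset.sum_congr rfl fun i hi => ?_
        have hik : k = i + (k - i) := by have := (Finset.mem_Icc.1 hi).2; omega
        conv_rhs => rw [hik, pow_add]
        rw [← hik, mul_pow]
        ring
      rw [this, hsum, mul_zero]

end SallyAux

lemma sally_uniq' (d : ℕ) (f : ℕ → ℤ) (N : ℕ)
    (h : ∀ n ≥ N, ∑ i ∈ Finset.range (d + 1), f i * ((n + d - i).choose (d - i) : ℕ) = 0) :
    ∀ i ≤ d, f i = 0 := by
  intro i hi
  have := sally_uniq d (fun j => f (d - j)) N (by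
    intro n hn
    rw [← h n hn, ← Finset.sum_range_reflect]
    refine Finset.sum_congr rfl fun j hj => ?_
    have hj' : j < d + 1 := Finset.mem_range.1 hj
    have h1 : d - (d + 1 - 1 - j) = j := by omega
    have h2 : d + 1 - 1 - j = d - j := by omega
    have h3 : n + d - j = n + (d - j) := by omega
    simp only [h1]
    rw [h2, h3]) (d - i) (by omega)
  have h1 : d - (d - i) = i := by omega
  simpa only [h1] using this

lemma sally_mlen (R M : Type*) [CommRing R] [AddCommGroup M] [Module R M] (k : ℕ)
    (h : mlen R M = (k : WithBot ℕ∞)) : Module.length R M = (k : ℕ∞) := by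
  apply WithBot.coe_injective
  rw [Module.coe_length]
  exact h

lemma sally_regular [CommRing R] [IsLocalRing R] [IsNoetherianRing R]
    (d : ℕ) (hd : 0 < d) (hdim : ringKrullDim R = d) (hCM : IsCMLocal R)
    (I J : Ideal R) (hI : IsMPrimary I) (hJ : IsMinimalReduction d J I) : SallyReg d J := by
  obtain ⟨hJI, ⟨s, hs⟩, N, hN⟩ := hJ
  have hrad : J.radical = maximalIdeal R := by
    rw [← (hI : I.radical = _)]
    apply le_antisymm (Ideal.radical_mono hJI)
    rw [Ideal.radical_le_radical_iff]
    intro x hx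
    refine ⟨N + 1, ?_⟩
    have := Ideal.pow_mem_pow hx (N + 1)
    rw [hN N le_rfl] at this
    exact sally_mul_left this
  have hdep : rdepth R (maximalIdeal R) R = (d : ℕ∞) := by
    apply WithBot.coe_injective
    rw [(hCM : _ = _), hdim]
    rfl
  obtain ⟨rs, hlen, hm, hreg⟩ : ∃ rs : List R, d ≤ rs.length ∧ (∀ x ∈ rs, x ∈ maximalIdeal R) ∧
      RingTheory.Sequence.IsRegular R rs := by
    have hlt : ((d - 1 : ℕ) : ℕ∞) < rdepth R (maximalIdeal R) R := by
      rw [hdep]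
      exact_mod_cast (by omega : d - 1 < d)
    obtain ⟨_, ⟨rs, rfl, hm, hreg⟩, hlt⟩ := lt_sSup_iff.1 hlt
    refine ⟨rs, ?_, hm, hreg⟩
    have : d - 1 < rs.length := by exact_mod_cast hlt
    omega
  have hG := sally_G_of_list (maximalIdeal R) rs hm hreg.toIsWeaklyRegular d 0 (by omega)
  have := sally_build J hrad d 0 ⊥ s .zero (by rw [bot_sup_eq, hs]) (by simpa using hG)
  simpa using this

theorem sally_hilbert_coefficients
    (R : Type*) [CommRing R] [IsLocalRing R] [IsNoetherianRing R]
    (d : ℕ) (hd : 0 < d) (hdim : ringKrullDim R = d)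
    (hCM : IsCMLocal R) (hAU : AnalyticallyUnramified R)
    (hres : Infinite (ResidueField R))
    (I J : Ideal R) (hI : IsMPrimary I) (hJ : IsMinimalReduction d J I)
    -- the normal Hilbert coefficients of `I`
    (L : ℕ → ℕ) (e : ℕ → ℤ) (hHilb : NormalHilbertData d I L e)
    -- the Sally module of the normal filtration is nonzero
    (hnz : ∃ n, 1 ≤ n ∧ ¬ intCl (I ^ (n + 1)) ≤ J ^ n * intCl I)
    -- `LS n = λ(S̄ₙ)` and the `s i` are the normalized Hilbert coefficients of `S̄`
    (LS : ℕ → ℕ)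
    (hLS : ∀ n, 1 ≤ n →
      mlen R (idealQuot (intCl (I ^ (n + 1))) (J ^ n * intCl I)) = (LS n : WithBot ℕ∞))
    (s : ℕ → ℤ)
    (hs : ∃ N : ℕ, ∀ n ≥ N, (LS n : ℤ) =
      ∑ i ∈ Finset.range d, (-1 : ℤ) ^ i * s i * ((n + (d - 1) - i).choose (d - 1 - i))) :
    s 0 = e 1 - e 0 + L 0 ∧ ∀ i, 1 ≤ i → i ≤ d - 1 → s i = e (i + 1) := by
  have hreg := sally_regular d hd hdim hCM I J hI hJ
  obtain ⟨D, rfl⟩ : ∃ D, d = D + 1 := ⟨d - 1, by omega⟩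
  have hJI := hJ.1
  obtain ⟨hL, N₁, hN₁⟩ := hHilb
  obtain ⟨N₂, hN₂⟩ := hs
  have hJK : J ≤ intCl I := hJI.trans (sally_le_intCl I)
  have hLtop : ∀ n, sallyLen ⊤ (intCl (I ^ (n + 1))) = (L n : ℕ∞) := fun n => by
    rw [sallyLen_top]
    exact sally_mlen _ _ _ (hL n)
  have hL0 : sallyLen ⊤ (intCl I) = (L 0 : ℕ∞) := by simpa using hLtop 0
  have hS : ∀ n, 1 ≤ n → sallyLen (intCl (I ^ (n + 1))) (J ^ n * intCl I) = (LS n : ℕ∞) :=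
    fun n hn => sally_mlen _ _ _ (hLS n hn)
  have hA : ∀ n, 1 ≤ n → sallyLen ⊤ (J ^ n * intCl I) = ((LS n + L n : ℕ) : ℕ∞) := fun n hn => by
    rw [sallyLen_add ⊤ (intCl (I ^ (n + 1))) _ le_top (sally_mul_le I J hJI n), hS n hn, hLtop n]
    push_cast
    rfl
  have hB : ∀ n, sallyLen ⊤ (J ^ n * intCl I) =
      ((n + D).choose D : ℕ) * (L 0 : ℕ∞) + ((n + D).choose (D + 1) : ℕ) * sallyLen ⊤ J :=
    fun n => by
    rw [sallyLen_add ⊤ (J ^ n) _ le_top (fun _ h => sally_mul_left h), sallyLen_top_pow hreg,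
      sallyLen_pow hreg _ hJK, hL0, ← Nat.choose_symm_add]
    rfl
  obtain ⟨c, hc⟩ : ∃ c : ℕ, sallyLen ⊤ J = (c : ℕ∞) := by
    have h1 := (hB 1).symm.trans (hA 1 le_rfl)
    have h2 : sallyLen ⊤ J ≠ ⊤ := by
      intro h
      rw [h, add_comm 1 D, Nat.choose_self, Nat.cast_one, one_mul, add_top] at h1
      exact ENat.top_ne_coe _ h1
    exact ⟨_, (ENat.coe_toNat h2).symm⟩
  have hrel : ∀ n, 1 ≤ n → ((LS n : ℤ) + L n =
      ((n + D).choose D : ℕ) * (L 0 : ℤ) + ((n + D).choose (D + 1) : ℕ) * (c : ℤ)) := by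
    intro n hn
    have h1 := (hA n hn).symm.trans (hB n)
    rw [hc] at h1
    exact_mod_cast h1
  let f : ℕ → ℤ := fun i => Nat.casesOn i (e 0 - c)
    (fun i => (-1 : ℤ) ^ i * (s i - e (i + 1)) + (if i = 0 then (c : ℤ) - L 0 else 0))
  have hf0 : f 0 = e 0 - c := rfl
  have hfs : ∀ i, f (i + 1) = (-1 : ℤ) ^ i * (s i - e (i + 1)) +
      (if i = 0 then (c : ℤ) - L 0 else 0) := fun i => rfl
  have hf := sally_uniq' (D + 1) f (N₁ + N₂ + 1) (by
    intro n hn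
    have r1 := hN₁ n (by omega)
    have r2 := hN₂ n (by omega)
    have r3 := hrel n (by omega)
    rw [Finset.sum_range_succ'] at r1 ⊢
    have e1 : ∀ i, n + (D + 1) - (i + 1) = n + D - i := fun i => by omega
    have e2 : ∀ i, D + 1 - (i + 1) = D - i := fun i => by omega
    simp only [e1, e2, hf0, hfs, Nat.add_sub_cancel, Nat.sub_zero] at r1 r2 ⊢
    have r4 : ∑ i ∈ Finset.range (D + 1), ((-1 : ℤ) ^ i * (s i - e (i + 1)) +
        (if i = 0 then (c : ℤ) - L 0 else 0)) * ((n + D - i).choose (D - i) : ℕ) =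
        ∑ i ∈ Finset.range (D + 1), (-1 : ℤ) ^ i * s i * ((n + D - i).choose (D - i) : ℕ) +
        ∑ i ∈ Finset.range (D + 1), (-1 : ℤ) ^ (i + 1) * e (i + 1) *
          ((n + D - i).choose (D - i) : ℕ) + ((c : ℤ) - L 0) * ((n + D).choose D : ℕ) := by
      have : ((c : ℤ) - L 0) * ((n + D).choose D : ℕ) = ∑ i ∈ Finset.range (D + 1),
          (if i = 0 then (c : ℤ) - L 0 else 0) * ((n + D - i).choose (D - i) : ℕ) := by
        simp
      rw [this, ← Finset.sum_add_distrib, ← Finset.sum_add_distrib]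
      refine Finset.sum_congr rfl fun i _ => ?_
      ring
    rw [r4, ← r2]
    have r5 : (((n + (D + 1)).choose (D + 1) : ℕ) : ℤ) =
        ((n + D).choose D : ℕ) + ((n + D).choose (D + 1) : ℕ) := by
      rw [← add_assoc, Nat.choose_succ_succ]
      push_cast
      rfl
    rw [r5] at r1 ⊢
    linear_combination r3 - r1)
  have h0 := hf 0 (by omega)
  rw [hf0] at h0
  constructor
  · have h1 := hf 1 (by omega)
    rw [show (1 : ℕ) = 0 + 1 from rfl, hfs] at h1
    simp at h1
    linarith
  · intro i hi hiD
    have h1 := hf (i + 1) (by omega)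
    rw [hfs, if_neg (by omega), add_zero] at h1
    have h2 : (-1 : ℤ) ^ i ≠ 0 := pow_ne_zero _ (by norm_num)
    rcases mul_eq_zero.1 h1 with h | h
    · exact absurd h h2
    · linarith
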